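/- arXiv:2004.05619 — 3 statements merged into one kernel-verified Lean document; each statement's English description precedes it below -/
import Mathlib

section
/- If the system is controllable, i.e., the controllability matrix P_n = [B, AB, …, A^{n−1}B] has rank n, then for every N ≥ n the origin is an interior point of the controllability region R(N); in particular R(N) is a full n-dimensional convex body. -/
open Matrix

/-- The controllability (reachability) region after `N` steps of the linear discrete-time
system `x_{k+1} = A x_k + B u_k` under the unit input constraint `‖u_k‖_∞ ≤ 1`. -/
def reachRegion {n r : ℕ} (A : Matrix (Fin n) (Fin n) ℝ) (B : Matrix (Fin n) (Fin r) ℝ)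
    (N : ℕ) : Set (Fin n → ℝ) :=
  {x | ∃ z : Fin N → Fin r → ℝ, (∀ k, ‖z k‖ ≤ 1) ∧
    x = ∑ k : Fin N, (A ^ (k : ℕ)) *ᵥ (B *ᵥ z k)}

/-- The controllability matrix `P_N = [B, AB, …, A^{N−1}B]`, as an `n × (N·r)` matrix whose
`(k, j)`-block column is the `j`-th column of `A^k B`. -/
def ctrbMatrix {n r : ℕ} (A : Matrix (Fin n) (Fin n) ℝ) (B : Matrix (Fin n) (Fin r) ℝ)
    (N : ℕ) : Matrix (Fin n) (Fin N × Fin r) ℝ :=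
  fun i p => ((A ^ (p.1 : ℕ)) * B) i p.2

/-- The linear map sending an input sequence `z` to the state `∑ k, A ^ k B z_k`. -/
def reachMap {n r : ℕ} (A : Matrix (Fin n) (Fin n) ℝ) (B : Matrix (Fin n) (Fin r) ℝ)
    (N : ℕ) : (Fin N → Fin r → ℝ) →ₗ[ℝ] (Fin n → ℝ) :=
  ∑ k : Fin N, (A ^ (k : ℕ) * B).mulVecLin ∘ₗ LinearMap.proj k

theorem reachMap_apply {n r : ℕ} (A : Matrix (Fin n) (Fin n) ℝ) (B : Matrix (Fin n) (Fin r) ℝ)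
    (N : ℕ) (z : Fin N → Fin r → ℝ) :
    reachMap A B N z = ∑ k : Fin N, (A ^ (k : ℕ)) *ᵥ (B *ᵥ z k) := by
  simp [reachMap, LinearMap.sum_apply, Matrix.mulVec_mulVec]

theorem reachRegion_eq_image_closedBall {n r : ℕ} (A : Matrix (Fin n) (Fin n) ℝ)
    (B : Matrix (Fin n) (Fin r) ℝ) (N : ℕ) :
    reachRegion A B N = reachMap A B N '' Metric.closedBall 0 1 := by
  ext x
  simp only [reachRegion, Set.mem_ofPred_eq, Set.mem_image, mem_closedBall_zero_iff,
    pi_norm_le_iff_of_nonneg zero_le_one, reachMap_apply, eq_comm]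

theorem ctrbMatrix_mulVec {n r : ℕ} (A : Matrix (Fin n) (Fin n) ℝ)
    (B : Matrix (Fin n) (Fin r) ℝ) (N : ℕ) (v : Fin N × Fin r → ℝ) :
    ctrbMatrix A B N *ᵥ v = reachMap A B N (Function.curry v) := by
  ext i
  simp [reachMap_apply, Matrix.mulVec_mulVec, Finset.sum_apply, Matrix.mulVec, dotProduct,
    ctrbMatrix, Fintype.sum_prod_type, Function.curry]

theorem reachMap_surjective {n r : ℕ} {A : Matrix (Fin n) (Fin n) ℝ}
    {B : Matrix (Fin n) (Fin r) ℝ} {N : ℕ} (h : (ctrbMatrix A B N).rank = n) :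
    Function.Surjective (reachMap A B N) := by
  have htop : LinearMap.range (ctrbMatrix A B N).mulVecLin = ⊤ := by
    apply Submodule.eq_top_of_finrank_eq
    simpa [Matrix.rank] using h
  intro x
  obtain ⟨v, hv⟩ := LinearMap.range_eq_top.mp htop x
  exact ⟨Function.curry v, by rw [← ctrbMatrix_mulVec, ← hv, Matrix.mulVecLin_apply]⟩

theorem reachRegion_mono {n r : ℕ} (A : Matrix (Fin n) (Fin n) ℝ)
    (B : Matrix (Fin n) (Fin r) ℝ) : Monotone (reachRegion A B) := by
  refine monotone_nat_of_le_succ fun N => ?_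
  rintro x ⟨z, hz, rfl⟩
  refine ⟨Fin.snoc (α := fun _ => Fin r → ℝ) z 0, fun k => ?_, ?_⟩
  · induction k using Fin.lastCases with
    | last => simp
    | cast k => simpa using hz k
  · simp [Fin.sum_univ_castSucc]

theorem zero_mem_interior_reachRegion {n r : ℕ} {A : Matrix (Fin n) (Fin n) ℝ}
    {B : Matrix (Fin n) (Fin r) ℝ} {N : ℕ} (h : (ctrbMatrix A B N).rank = n) :
    (0 : Fin n → ℝ) ∈ interior (reachRegion A B N) := by
  have hopen : IsOpenMap (reachMap A B N) :=
    (reachMap A B N).isOpenMap_of_finiteDimensional (reachMap_surjective h)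
  rw [reachRegion_eq_image_closedBall, mem_interior_iff_mem_nhds, ← map_zero (reachMap A B N)]
  exact hopen.image_mem_nhds (Metric.closedBall_mem_nhds 0 one_pos)

/-- If the system is controllable (`rank P_n = n`), then for every `N ≥ n` the origin is an
interior point of `R(N)`; in particular `R(N)` is a full `n`-dimensional convex body
(its interior is nonempty). -/
theorem zero_mem_interior_reachRegion_of_controllable {n r : ℕ}
    (A : Matrix (Fin n) (Fin n) ℝ) (B : Matrix (Fin n) (Fin r) ℝ)
    (hctrb : (ctrbMatrix A B n).rank = n) (N : ℕ) (hN : n ≤ N) :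
    (0 : Fin n → ℝ) ∈ interior (reachRegion A B N) ∧
      (interior (reachRegion A B N)).Nonempty := by
  have h0 : (0 : Fin n → ℝ) ∈ interior (reachRegion A B N) :=
    interior_mono (reachRegion_mono A B hN) (zero_mem_interior_reachRegion hctrb)
  exact ⟨h0, 0, h0⟩
end

section
/- If A is invertible and B ≠ 0, then the controllability regions are strictly monotonically expanding: for all positive integers N₁ < N₂, R(N₁) is a proper subset of R(N₂). -/
open Matrix

section ReachRegion

variable {n r : ℕ} (A : Matrix (Fin n) (Fin n) ℝ) (B : Matrix (Fin n) (Fin r) ℝ)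

theorem zero_mem_reachRegion (N : ℕ) : (0 : Fin n → ℝ) ∈ reachRegion A B N :=
  ⟨0, by simp, by simp⟩

theorem add_mem_reachRegion_succ {N : ℕ} {x : Fin n → ℝ} (hx : x ∈ reachRegion A B N)
    {u : Fin r → ℝ} (hu : ‖u‖ ≤ 1) :
    x + (A ^ N) *ᵥ (B *ᵥ u) ∈ reachRegion A B (N + 1) := by
  obtain ⟨z, hz, rfl⟩ := hx
  refine ⟨Fin.snoc (α := fun _ => Fin r → ℝ) z u, fun k => ?_, ?_⟩
  · refine Fin.lastCases ?_ (fun i => ?_) k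
    · simpa using hu
    · simpa using hz i
  · simp [Fin.sum_univ_castSucc]

theorem monotone_reachRegion : Monotone (reachRegion A B) :=
  monotone_nat_of_le_succ fun N x hx => by
    simpa using add_mem_reachRegion_succ A B hx (u := 0) (by simp)

theorem isCompact_reachRegion (N : ℕ) : IsCompact (reachRegion A B N) := by
  have h : reachRegion A B N =
      (fun z : Fin N → Fin r → ℝ => ∑ k : Fin N, (A ^ (k : ℕ)) *ᵥ (B *ᵥ z k)) ''
        Metric.closedBall 0 1 := by
    ext x
    simp only [reachRegion, Set.mem_ofPred_eq, Set.mem_image, mem_closedBall_zero_iff,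
      pi_norm_le_iff_of_nonneg zero_le_one, eq_comm]
  rw [h]
  exact (isCompact_closedBall _ _).image (by fun_prop)

end ReachRegion

/-- A nonempty set stable under translation by a nonzero vector is unbounded. -/
theorem not_isBounded_of_add_mem {E : Type*} [NormedAddCommGroup E] [NormedSpace ℝ E]
    {S : Set E} (h0 : (0 : E) ∈ S) {v : E} (hv : v ≠ 0) (h : ∀ x ∈ S, x + v ∈ S) :
    ¬ Bornology.IsBounded S := by
  intro hS
  obtain ⟨C, hC⟩ := hS.exists_norm_le
  have hmem : ∀ m : ℕ, (m : ℝ) • v ∈ S := by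
    intro m
    induction m with
    | zero => simpa using h0
    | succ m ih => simpa [add_smul] using h _ ih
  obtain ⟨m, hm⟩ := exists_nat_gt (C / ‖v‖)
  have hle := hC _ (hmem m)
  rw [norm_smul, Real.norm_natCast] at hle
  exact absurd hle (not_le.mpr ((div_lt_iff₀ (norm_pos_iff.mpr hv)).mp hm))

/-- If `A` is invertible and `B ≠ 0`, then the controllability regions are strictly
monotonically expanding: for all positive `N₁ < N₂`, `R(N₁) ⊊ R(N₂)`. -/
theorem reachRegion_ssubset {n r : ℕ}
    (A : Matrix (Fin n) (Fin n) ℝ) (B : Matrix (Fin n) (Fin r) ℝ)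
    (hA : IsUnit A.det) (hB : B ≠ 0)
    (N₁ N₂ : ℕ) (hN₁ : 0 < N₁) (h : N₁ < N₂) :
    reachRegion A B N₁ ⊂ reachRegion A B N₂ := by
  refine ⟨monotone_reachRegion A B h.le, fun hsub => ?_⟩
  obtain ⟨j, hj⟩ : ∃ j, B *ᵥ Pi.single j 1 ≠ 0 := by
    by_contra! hzero
    exact hB (Matrix.ext_of_mulVec_single fun j => by rw [hzero j, Matrix.zero_mulVec])
  have hunit : IsUnit (A ^ N₁) := ((Matrix.isUnit_iff_isUnit_det A).mpr hA).pow N₁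
  have hv : (A ^ N₁) *ᵥ (B *ᵥ Pi.single j 1) ≠ 0 := fun h0 =>
    hj (Matrix.mulVec_injective_of_isUnit hunit (by simpa using h0))
  refine not_isBounded_of_add_mem (zero_mem_reachRegion A B N₁) hv (fun x hx => ?_)
    (isCompact_reachRegion A B N₁).isBounded
  refine hsub (monotone_reachRegion A B h (add_mem_reachRegion_succ A B hx ?_))
  simp [Pi.norm_single]
end

section
/- Suppose the controllability matrix P_n = [B, AB, …, A^{n−1}B] has rank n and N ≥ n. If x₀ is an interior point of R(N), then the solution space U_N(x₀) = { (z_0, …, z_{N-1}) ∈ (ℝ^r)^N : ∑_{i=0}^{N-1} A^i B z_i = x₀ and ‖z_i‖_∞ ≤ 1 for all i } contains a point z with ‖z_i‖_∞ < 1 for every i, and the direction of the affine span of U_N(x₀) has dimension Nr − n. -/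
open Matrix

/-- The solution space `U_N(x₀)` of admissible input sequences of length `N` steering the
origin to `x₀`. -/
def solutionSpace {n r : ℕ} (A : Matrix (Fin n) (Fin n) ℝ) (B : Matrix (Fin n) (Fin r) ℝ)
    (N : ℕ) (x₀ : Fin n → ℝ) : Set (Fin N → Fin r → ℝ) :=
  {z | (∑ i : Fin N, (A ^ (i : ℕ)) *ᵥ (B *ᵥ z i)) = x₀ ∧ ∀ i, ‖z i‖ ≤ 1}

/-- The linear map sending an input sequence of length `N` to the state it reaches from the
origin. -/
def inputToState {n r : ℕ} (A : Matrix (Fin n) (Fin n) ℝ) (B : Matrix (Fin n) (Fin r) ℝ)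
    (N : ℕ) : (Fin N → Fin r → ℝ) →ₗ[ℝ] (Fin n → ℝ) :=
  ∑ i : Fin N, (A ^ (i : ℕ)).mulVecLin ∘ₗ B.mulVecLin ∘ₗ LinearMap.proj i

theorem inputToState_apply {n r : ℕ} (A : Matrix (Fin n) (Fin n) ℝ)
    (B : Matrix (Fin n) (Fin r) ℝ) (N : ℕ) (z : Fin N → Fin r → ℝ) :
    inputToState A B N z = ∑ i : Fin N, (A ^ (i : ℕ)) *ᵥ (B *ᵥ z i) := by
  simp [inputToState]

theorem reachRegion_eq_image {n r : ℕ} (A : Matrix (Fin n) (Fin n) ℝ)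
    (B : Matrix (Fin n) (Fin r) ℝ) (N : ℕ) :
    reachRegion A B N = inputToState A B N '' Metric.closedBall 0 1 := by
  ext x
  simp [reachRegion, inputToState_apply, pi_norm_le_iff_of_nonneg, eq_comm]

theorem solutionSpace_eq {n r : ℕ} (A : Matrix (Fin n) (Fin n) ℝ)
    (B : Matrix (Fin n) (Fin r) ℝ) (N : ℕ) (x₀ : Fin n → ℝ) :
    solutionSpace A B N x₀ = {z | inputToState A B N z = x₀ ∧ ‖z‖ ≤ 1} := by
  ext z
  simp [solutionSpace, inputToState_apply, pi_norm_le_iff_of_nonneg]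

section

variable {E F : Type*} [NormedAddCommGroup E] [NormedSpace ℝ E]

theorem LinearMap.surjective_of_interior_image_nonempty [NormedAddCommGroup F] [NormedSpace ℝ F]
    (L : E →ₗ[ℝ] F) {s : Set E} (h : (interior (L '' s)).Nonempty) : Function.Surjective L := by
  rw [← LinearMap.range_eq_top]
  refine Submodule.eq_top_of_nonempty_interior' _ (h.mono (interior_mono ?_))
  rintro _ ⟨z, -, rfl⟩
  exact ⟨z, rfl⟩

theorem LinearMap.exists_norm_lt_one_of_mem_interior_image [NormedAddCommGroup F]
    [NormedSpace ℝ F] (L : E →ₗ[ℝ] F) {x : F}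
    (hx : x ∈ interior (L '' Metric.closedBall 0 1)) : ∃ z, L z = x ∧ ‖z‖ < 1 := by
  have hcont : Filter.Tendsto (fun c : ℝ => c • x) (nhds 1) (nhds x) := by
    have : Continuous fun c : ℝ => c • x := by fun_prop
    simpa using this.tendsto 1
  have hev : ∀ᶠ c : ℝ in nhdsWithin 1 (Set.Ioi 1), c • x ∈ L '' Metric.closedBall 0 1 :=
    nhdsWithin_le_nhds (hcont (mem_interior_iff_mem_nhds.1 hx))
  obtain ⟨c, ⟨w, hw, hwc⟩, hc⟩ := (hev.and self_mem_nhdsWithin).exists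
  have hc1 : (1 : ℝ) < c := hc
  have hc0 : 0 < c := by linarith
  refine ⟨c⁻¹ • w, by rw [map_smul, hwc, inv_smul_smul₀ hc0.ne'], ?_⟩
  rw [norm_smul, Real.norm_of_nonneg (inv_nonneg.2 hc0.le)]
  calc c⁻¹ * ‖w‖ ≤ c⁻¹ * 1 := by gcongr; simpa using hw
    _ < 1 := by rw [mul_one]; exact inv_lt_one_of_one_lt₀ hc1

theorem LinearMap.vectorSpan_fiber_inter_closedBall [AddCommGroup F] [Module ℝ F]
    (L : E →ₗ[ℝ] F) {z : E} (hz : ‖z‖ < 1) :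
    vectorSpan ℝ {w | L w = L z ∧ ‖w‖ ≤ 1} = LinearMap.ker L := by
  apply le_antisymm
  · rw [vectorSpan_def, Submodule.span_le]
    rintro _ ⟨a, ha, b, hb, rfl⟩
    simp [ha.1, hb.1]
  · intro v hv
    have hcont : Filter.Tendsto (fun t : ℝ => ‖z + t • v‖) (nhds 0) (nhds ‖z‖) := by
      have : Continuous fun t : ℝ => ‖z + t • v‖ := by fun_prop
      simpa using this.tendsto 0
    have hev : ∀ᶠ t : ℝ in nhdsWithin 0 (Set.Ioi 0), ‖z + t • v‖ < 1 :=
      nhdsWithin_le_nhds (hcont.eventually_lt_const hz)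
    obtain ⟨t, ht, ht0⟩ := (hev.and self_mem_nhdsWithin).exists
    have ht0' : t ≠ 0 := ne_of_gt ht0
    have hmem := vsub_mem_vectorSpan ℝ (s := {w | L w = L z ∧ ‖w‖ ≤ 1})
      (p₁ := z + t • v) (p₂ := z) ⟨by simp [LinearMap.mem_ker.1 hv], ht.le⟩ ⟨rfl, hz.le⟩
    rw [vsub_eq_sub, add_sub_cancel_left] at hmem
    exact (Submodule.smul_mem_iff _ ht0').1 hmem

end


/-- If `rank P_n = n`, `N ≥ n`, and `x₀` is an interior point of `R(N)`, then the solution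
space `U_N(x₀)` contains a strictly admissible point (`‖z_i‖_∞ < 1` for all `i`) and the
direction of its affine span has dimension `N·r − n`. -/
theorem solutionSpace_of_interior_point {n r : ℕ}
    (A : Matrix (Fin n) (Fin n) ℝ) (B : Matrix (Fin n) (Fin r) ℝ)
    (hctrb : (ctrbMatrix A B n).rank = n) (N : ℕ) (hN : n ≤ N)
    (x₀ : Fin n → ℝ) (hx : x₀ ∈ interior (reachRegion A B N)) :
    (∃ z ∈ solutionSpace A B N x₀, ∀ i, ‖z i‖ < 1) ∧
      Module.finrank ℝ (vectorSpan ℝ (solutionSpace A B N x₀)) = N * r - n := by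
  rw [reachRegion_eq_image] at hx
  obtain ⟨z, rfl, hz⟩ := (inputToState A B N).exists_norm_lt_one_of_mem_interior_image hx
  rw [solutionSpace_eq]
  refine ⟨⟨z, ⟨rfl, hz.le⟩, (pi_norm_lt_iff one_pos).1 hz⟩, ?_⟩
  rw [LinearMap.vectorSpan_fiber_inter_closedBall _ hz]
  have hrange := LinearMap.range_eq_top.2
    ((inputToState A B N).surjective_of_interior_image_nonempty ⟨_, hx⟩)
  have hrank := (inputToState A B N).finrank_range_add_finrank_ker
  rw [hrange, finrank_top] at hrank
  simp only [Module.finrank_pi_fintype, Module.finrank_self, Finset.sum_const,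
    Finset.card_univ, Fintype.card_fin, smul_eq_mul, mul_one] at hrank
  omega
end
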